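/- Let u,v ∈ ℝ⁴ with v0 ≠ 0 and u not proportional to v (there is no c ∈ ℝ with u = c·v or v = c·u). Let α > 0 and β ∈ ℝ satisfy Δ_{32}(u,v)(α,β) = 0 (i.e. (α,β) lies on the numerical λ-wall at s = 1/3). Then the gradient of the map (α,β) ↦ Δ_{32}(u,v)(α,β) vanishes at (α,β) if and only if τ_{u,1/3}(α,β) = 0, τ_{v,1/3}(α,β) = 0 and Δ_{21}(u,v)(α,β) = 0. In particular, at s = 1/3 the numerical λ-wall Υ_{u,v,1/3} is a regular curve except at points lying simultaneously on Γ_{u,1/3}, Γ_{v,1/3} and the numerical ν-wall Ξ_{u,v}. -/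

import Mathlib

noncomputable section

/-- `ρ_v(α,β) = v2 − βv1 + (β²−α²)v0/2`. -/
def rho (v : Fin 4 → ℝ) (α β : ℝ) : ℝ :=
  v 2 - β * v 1 + (β ^ 2 - α ^ 2) * v 0 / 2

/-- `τ_{v,s}(α,β)`. -/
def tau (v : Fin 4 → ℝ) (s α β : ℝ) : ℝ :=
  v 3 - β * v 2 + β ^ 2 / 2 * v 1 - β ^ 3 / 6 * v 0 - (s + 1 / 6) * (v 1 - β * v 0) * α ^ 2

/-- The twisted Chern character `ch^{α,β}(v)` (with `ch₃^{α,β} = τ_{v,1/3}`). -/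
def chab (v : Fin 4 → ℝ) (α β : ℝ) : Fin 4 → ℝ :=
  ![v 0, v 1 - β * v 0, rho v α β, tau v (1 / 3) α β]

/-- `Δ_{ij}(u,v)(α,β) = ch_i^{α,β}(u)ch_j^{α,β}(v) − ch_j^{α,β}(u)ch_i^{α,β}(v)`. -/
def Dlt (u v : Fin 4 → ℝ) (α β : ℝ) (i j : Fin 4) : ℝ :=
  chab u α β i * chab v α β j - chab u α β j * chab v α β i

open ContinuousLinearMap in
theorem hasFDerivAt_rho (w : Fin 4 → ℝ) (α β : ℝ) :
    HasFDerivAt (fun p : ℝ × ℝ => rho w p.1 p.2)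
      ((-(α * w 0)) • fst ℝ ℝ ℝ + (-(w 1 - β * w 0)) • snd ℝ ℝ ℝ) (α, β) := by
  have hα : HasFDerivAt (fun p : ℝ × ℝ => p.1) (fst ℝ ℝ ℝ) (α, β) := hasFDerivAt_fst
  have hβ : HasFDerivAt (fun p : ℝ × ℝ => p.2) (snd ℝ ℝ ℝ) (α, β) := hasFDerivAt_snd
  refine (((hβ.mul_const (w 1)).const_sub (w 2)).add
    ((((hβ.pow 2).sub (hα.pow 2)).mul_const (w 0)).mul_const (2⁻¹))).congr_fderiv ?_
  ext <;> simp <;> ring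

open ContinuousLinearMap in
theorem hasFDerivAt_tau (w : Fin 4 → ℝ) (α β : ℝ) :
    HasFDerivAt (fun p : ℝ × ℝ => tau w (1 / 3) p.1 p.2)
      ((-(α * (w 1 - β * w 0))) • fst ℝ ℝ ℝ + (-rho w α β) • snd ℝ ℝ ℝ) (α, β) := by
  have hα : HasFDerivAt (fun p : ℝ × ℝ => p.1) (fst ℝ ℝ ℝ) (α, β) := hasFDerivAt_fst
  have hβ : HasFDerivAt (fun p : ℝ × ℝ => p.2) (snd ℝ ℝ ℝ) (α, β) := hasFDerivAt_snd
  refine (((((hβ.mul_const (w 2)).const_sub (w 3)).add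
    (((hβ.pow 2).mul_const (2⁻¹)).mul_const (w 1))).sub
    (((hβ.pow 3).mul_const (6⁻¹)).mul_const (w 0))).sub
    ((((hβ.mul_const (w 0)).const_sub (w 1)).const_mul (1 / 3 + 1 / 6)).mul
      (hα.pow 2))).congr_fderiv ?_
  ext <;> simp [rho] <;> ring

open ContinuousLinearMap in
/-- The partial derivatives of `Δ₃₂` are `α(Δ₂₁ − Δ₃₀)` and `−Δ₃₁`. -/
theorem hasFDerivAt_Dlt_three_two (u v : Fin 4 → ℝ) (α β : ℝ) :
    HasFDerivAt (fun p : ℝ × ℝ => Dlt u v p.1 p.2 3 2)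
      ((α * (Dlt u v α β 2 1 - Dlt u v α β 3 0)) • fst ℝ ℝ ℝ +
        (-Dlt u v α β 3 1) • snd ℝ ℝ ℝ) (α, β) := by
  refine (((hasFDerivAt_tau u α β).mul (hasFDerivAt_rho v α β)).sub
    ((hasFDerivAt_rho u α β).mul (hasFDerivAt_tau v α β))).congr_fderiv ?_
  ext <;> simp [Dlt, chab] <;> ring

theorem fderiv_Dlt_three_two_eq_zero_iff (u v : Fin 4 → ℝ) {α : ℝ} (β : ℝ) (hα : α ≠ 0) :
    fderiv ℝ (fun p : ℝ × ℝ => Dlt u v p.1 p.2 3 2) (α, β) = 0 ↔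
      Dlt u v α β 2 1 = Dlt u v α β 3 0 ∧ Dlt u v α β 3 1 = 0 := by
  rw [(hasFDerivAt_Dlt_three_two u v α β).fderiv]
  constructor
  · intro h
    have h₁ := DFunLike.congr_fun h (1, 0)
    have h₂ := DFunLike.congr_fun h (0, 1)
    simp [hα] at h₁ h₂
    exact ⟨sub_eq_zero.mp h₁, h₂⟩
  · rintro ⟨h₁, h₂⟩
    simp [h₁, h₂]

theorem Dlt_plucker (u v : Fin 4 → ℝ) (α β : ℝ) :
    Dlt u v α β 3 0 * Dlt u v α β 2 1 - Dlt u v α β 3 1 * Dlt u v α β 2 0 +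
      Dlt u v α β 3 2 * Dlt u v α β 1 0 = 0 := by
  simp only [Dlt]
  ring

/-- Twisting is linear and injective, so it reflects proportionality. -/
theorem eq_smul_of_chab_eq_smul {u v : Fin 4 → ℝ} {α β c : ℝ}
    (h : chab u α β = c • chab v α β) : u = c • v := by
  have h₀ := congrFun h 0
  have h₁ := congrFun h 1
  have h₂ := congrFun h 2
  have h₃ := congrFun h 3
  simp [chab, rho, tau] at h₀ h₁ h₂ h₃
  have k₁ : u 1 = c * v 1 := by linear_combination h₁ + β * h₀
  have k₂ : u 2 = c * v 2 := by
    linear_combination h₂ + β * k₁ - (β ^ 2 - α ^ 2) / 2 * h₀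
  have k₃ : u 3 = c * v 3 := by
    linear_combination h₃ + β * k₂ - β ^ 2 / 2 * k₁ + β ^ 3 / 6 * h₀ +
      (3⁻¹ + 6⁻¹) * α ^ 2 * (k₁ - β * h₀)
  ext i
  fin_cases i <;> simp [h₀, k₁, k₂, k₃]

theorem Dlt_swap (u v : Fin 4 → ℝ) (α β : ℝ) (i j : Fin 4) :
    Dlt v u α β i j = -Dlt u v α β i j := by
  simp only [Dlt]
  ring

theorem eq_smul_of_Dlt_three_eq_zero {u v : Fin 4 → ℝ} {α β : ℝ}
    (hv : tau v (1 / 3) α β ≠ 0) (h : ∀ j, Dlt u v α β 3 j = 0) :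
    ∃ c : ℝ, u = c • v := by
  have hv' : chab v α β 3 ≠ 0 := hv
  refine ⟨chab u α β 3 / chab v α β 3, eq_smul_of_chab_eq_smul (α := α) (β := β) ?_⟩
  ext j
  have hj := h j
  simp only [Dlt] at hj
  simp only [Pi.smul_apply, smul_eq_mul]
  field_simp
  linear_combination -hj

/-- At `s = 1/3`, the numerical λ-wall `{Δ₃₂ = 0}` is singular at a point exactly when the
point lies simultaneously on `Γ_{u,1/3}`, `Γ_{v,1/3}` and the numerical ν-wall `Ξ_{u,v}`. -/
theorem lambda_wall_singular_iff
    (u v : Fin 4 → ℝ) (hv0 : v 0 ≠ 0)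
    (hprop : ¬ ∃ c : ℝ, u = c • v ∨ v = c • u)
    (α β : ℝ) (hα : 0 < α) (hwall : Dlt u v α β 3 2 = 0) :
    fderiv ℝ (fun p : ℝ × ℝ => Dlt u v p.1 p.2 3 2) (α, β) = 0 ↔
      tau u (1 / 3) α β = 0 ∧ tau v (1 / 3) α β = 0 ∧ Dlt u v α β 2 1 = 0 := by
  rw [fderiv_Dlt_three_two_eq_zero_iff u v β hα.ne']
  constructor
  · rintro ⟨h, h₁⟩
    have h₂₁ : Dlt u v α β 2 1 = 0 := by
      have := Dlt_plucker u v α β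
      rw [h₁, hwall, ← h] at this
      simpa using this
    have hu : ∀ j, Dlt u v α β 3 j = 0 := by
      intro j
      fin_cases j
      · exact h.symm.trans h₂₁
      · exact h₁
      · exact hwall
      · simp [Dlt]
    refine ⟨?_, ?_, h₂₁⟩
    · by_contra hne
      obtain ⟨c, hc⟩ := eq_smul_of_Dlt_three_eq_zero (u := v) hne
        fun j => by rw [Dlt_swap, hu, neg_zero]
      exact hprop ⟨c, Or.inr hc⟩
    · by_contra hne
      obtain ⟨c, hc⟩ := eq_smul_of_Dlt_three_eq_zero hne hu
      exact hprop ⟨c, Or.inl hc⟩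
  · rintro ⟨hu, hv, h⟩
    have hu' : chab u α β 3 = 0 := hu
    have hv' : chab v α β 3 = 0 := hv
    refine ⟨?_, ?_⟩
    · rw [h]
      simp [Dlt, hu', hv']
    · simp [Dlt, hu', hv']
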